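/- Let n = 2r with r ≥ 1 and let k ≥ 0. Let f be a k-multilinear ℂ-valued map on so(n,ℂ) = {X : Matrix (Fin n) (Fin n) ℂ | Xᵀ = −X} such that f(S X₁ S⁻¹, …, S X_k S⁻¹) = f(X₁, …, X_k) for every S in SO(n,ℂ) (complex n×n matrices with Sᵀ S = 1 and det S = 1) and all skew-symmetric X₁,…,X_k. Then f lies in the ℂ-linear span of the set consisting of (i) the restrictions to so(n,ℂ) of the trace monomials T_σ for permutations σ of {1,…,k}, and (ii) the maps (X₁,…,X_k) ↦ E(w₁,…,w_r)(X₁,…,X_k) · T_σ'(X_j : j ∉ S), where S ⊆ {1,…,k}, (w₁,…,w_r) is an ordered partition of S into r nonempty sequences, σ' is a permutation of the complement of S, and E(w₁,…,w_r)(X₁,…,X_k) := ∑_{τ ∈ S_{2r}} sign(τ) ∏_{i=1}^{r} (X_{w_i(1)} X_{w_i(2)} ⋯ X_{w_i(ℓ_i)})_{τ(i), τ(r+i)}, with ℓ_i the length of the sequence w_i. -/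

import Mathlib

/-!
STATEMENT 3 (D_r case of the main theorem): every `SO(2r,ℂ)`-invariant `k`-multilinear
map on `so(2r,ℂ)` lies in the ℂ-span of (i) restricted trace monomials `T_σ` and
(ii) products of a Levi-Civita contraction `E(w₁,…,w_r)` of `r` chains of matrix
products (the chains indexed by an ordered partition `w` of a subset `S ⊆ {1,…,k}`
into `r` nonempty sequences) with a trace monomial `T_{σ'}` in the remaining arguments.

Trace monomials are realized by the standard entry formula
`T_σ (X₁,…,X_k) = ∑_{j} ∏ i, (X i) (j i) (j (σ i))`, which equals the product over
the cycles `(i₁ … i_m)` of `σ` of `tr (X_{i₁} ⋯ X_{i_m})`.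
-/

/-- The Lie algebra `so(n,ℂ)` of skew-symmetric complex `n × n` matrices,
as a submodule of the matrix space. -/
noncomputable def soSubmodule (n : ℕ) : Submodule ℂ (Matrix (Fin n) (Fin n) ℂ) where
  carrier := {X | X.transpose = -X}
  add_mem' := by
    intro a b ha hb
    simp only [Set.mem_setOf_eq] at *
    rw [Matrix.transpose_add, ha, hb, neg_add]
  zero_mem' := by simp
  smul_mem' := by
    intro c a ha
    simp only [Set.mem_setOf_eq] at *
    rw [Matrix.transpose_smul, ha, smul_neg]



open Function

set_option linter.unusedSectionVars false
set_option linter.unusedSimpArgs false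

namespace SOInv

section Casimir

variable {V ι : Type} [Fintype V] [DecidableEq V] [Fintype ι] [DecidableEq ι]

/-- Action of the elementary matrix with indices `a b` on tensors with slots `ι`. -/
def Dop (a b : V) (c : (ι → V) → ℂ) : (ι → V) → ℂ :=
  fun J => ∑ s, if J s = a then c (update J s b) else 0

/-- Infinitesimal invariance under the orthogonal group. -/
def Inv (c : (ι → V) → ℂ) : Prop := ∀ a b, Dop a b c = Dop b a c

/-- Contraction of the slots `s`, `t` followed by insertion of a Kronecker delta. -/
def Kop (s t : ι) (c : (ι → V) → ℂ) : (ι → V) → ℂ :=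
  fun J => if J s = J t then ∑ x, c (update (update J s x) t x) else 0

/-- The Casimir type operator. -/
def Aop (c : (ι → V) → ℂ) : (ι → V) → ℂ :=
  fun J => (Fintype.card ι : ℂ) * ((Fintype.card V : ℂ) - 1) * c J
    + ∑ s : ι, ∑ t : ι, if s = t then 0 else c (J ∘ Equiv.swap s t)

lemma update_swap (J : ι → V) {s t : ι} (h : s ≠ t) :
    update (update J s (J t)) t (J s) = J ∘ Equiv.swap s t := by
  funext u
  by_cases h1 : u = t
  · subst h1; simp
  · by_cases h2 : u = s
    · subst h2; simp [h1]
    · simp [h1, h2, Equiv.swap_apply_of_ne_of_ne]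

lemma DD_general (a' b' : V → V → V) (c : (ι → V) → ℂ) (J : ι → V) :
    ∑ a, ∑ b, Dop a b (Dop (a' a b) (b' a b) c) J =
    ∑ s, ∑ t, ∑ b, if (update J s b) t = a' (J s) b
      then c (update (update J s b) t (b' (J s) b)) else 0 := by
  simp only [Dop]
  calc _ = ∑ a, ∑ s, ∑ b, if J s = a then (∑ t, if (update J s b) t = a' a b
      then c (update (update J s b) t (b' a b)) else 0) else 0 := by
        refine Finset.sum_congr rfl fun a _ => ?_
        rw [Finset.sum_comm]
    _ = _ := by
        rw [Finset.sum_comm]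
        refine Finset.sum_congr rfl fun s _ => ?_
        rw [Finset.sum_comm]
        rw [Finset.sum_comm (s := Finset.univ (α := ι))]
        refine Finset.sum_congr rfl fun b _ => ?_
        simp

lemma DD_swap (c : (ι → V) → ℂ) (J : ι → V) :
    ∑ a, ∑ b, Dop a b (Dop b a c) J = (Fintype.card ι : ℂ) * c J + Aop c J := by
  rw [DD_general (fun _ b => b) (fun a _ => a)]
  have : ∀ s t : ι, (∑ b, if (update J s b) t = b
      then c (update (update J s b) t (J s)) else 0) =
      (if s = t then (Fintype.card V : ℂ) * c J else 0)
        + if s = t then 0 else c (J ∘ Equiv.swap s t) := by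
    intro s t
    by_cases h : s = t
    · subst h; simp
    · have h' : t ≠ s := fun e => h e.symm
      simp only [h, if_false, zero_add, update_of_ne h']
      simp [update_swap J h]
  simp only [this, Finset.sum_add_distrib, Aop]
  simp
  ring

lemma DD_K (c : (ι → V) → ℂ) (J : ι → V) :
    ∑ a, ∑ b, Dop a b (Dop a b c) J = (Fintype.card ι : ℂ) * c J
      + ∑ s : ι, ∑ t : ι, if s = t then 0 else Kop s t c J := by
  rw [DD_general (fun a _ => a) (fun _ b => b)]
  have : ∀ s t : ι, (∑ b, if (update J s b) t = J s
      then c (update (update J s b) t b) else 0) =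
      (if s = t then c J else 0)
        + if s = t then 0 else Kop s t c J := by
    intro s t
    by_cases h : s = t
    · subst h; simp
    · have h' : t ≠ s := fun e => h e.symm
      simp only [h, if_false, zero_add, update_of_ne h', Kop]
      by_cases h2 : J s = J t
      · simp [h2]
      · have h3 : ¬ J t = J s := fun e => h2 e.symm
        simp [h2, h3]
  simp only [this, Finset.sum_add_distrib]
  simp

lemma Aop_of_inv (c : (ι → V) → ℂ) (hc : Inv c) :
    Aop c = ∑ s : ι, ∑ t : ι, if s = t then 0 else Kop s t c := by
  funext J
  have h1 := DD_swap c J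
  have h2 := DD_K c J
  have : ∀ a b, Dop a b (Dop b a c) J = Dop a b (Dop a b c) J := by
    intro a b; rw [hc a b]
  simp only [this] at h1
  rw [h1] at h2
  have h3 := add_left_cancel h2
  rw [h3]
  simp only [Finset.sum_apply]
  refine Finset.sum_congr rfl fun s _ => Finset.sum_congr rfl fun t _ => ?_
  split_ifs <;> rfl

/-- hermitian form -/
def hform {X : Type} [Fintype X] (u v : X → ℂ) : ℂ := ∑ J, star (u J) * v J

lemma hform_self_eq_zero {X : Type} [Fintype X] (u : X → ℂ) (h : hform u u = 0) : u = 0 := by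
  have h1 : ∀ J, star (u J) * u J = ((Complex.normSq (u J) : ℝ) : ℂ) := by
    intro J
    rw [Complex.normSq_eq_conj_mul_self]; rfl
  simp only [hform, h1] at h
  rw [← Complex.ofReal_sum, Complex.ofReal_eq_zero,
    Finset.sum_eq_zero_iff_of_nonneg (fun _ _ => Complex.normSq_nonneg _)] at h
  funext J
  simpa using h J (Finset.mem_univ _)

lemma adj (a b : V) (u v : (ι → V) → ℂ) : hform u (Dop a b v) = hform (Dop b a u) v := by
  simp only [hform, Dop, Finset.mul_sum, star_sum, Finset.sum_mul]
  rw [Finset.sum_comm]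
  conv_rhs => rw [Finset.sum_comm]
  refine Finset.sum_congr rfl fun s _ => ?_
  let e : (ι → V) ≃ (ι → V) := Function.Involutive.toPerm
    (fun J => update J s (Equiv.swap a b (J s))) (fun J => by simp)
  refine Fintype.sum_equiv e _ _ fun J => ?_
  have he : e J = update J s (Equiv.swap a b (J s)) := rfl
  rw [he]
  by_cases h : J s = a
  · rw [h]
    have : update J s a = J := by rw [← h]; simp
    simp [h, this]
  · have : Equiv.swap a b (J s) ≠ b := by
      intro h2
      apply h
      have := (Equiv.swap a b).injective (h2.trans (Equiv.swap_apply_left a b).symm)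
      exact this
    simp [h, this]

lemma Aop_symm (u v : (ι → V) → ℂ) : hform u (Aop v) = hform (Aop u) v := by
  simp only [hform, Aop, mul_add, star_add, add_mul, Finset.sum_add_distrib]
  congr 1
  · refine Finset.sum_congr rfl fun J _ => ?_
    simp
    ring
  · simp only [Finset.mul_sum, star_sum, Finset.sum_mul]
    rw [Finset.sum_comm]
    conv_rhs => rw [Finset.sum_comm]
    refine Finset.sum_congr rfl fun s _ => ?_
    rw [Finset.sum_comm]
    conv_rhs => rw [Finset.sum_comm]
    refine Finset.sum_congr rfl fun t _ => ?_
    by_cases h : s = t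
    · simp [h]
    · simp only [h, if_false]
      refine Fintype.sum_equiv ((Equiv.swap s t).arrowCongr (Equiv.refl V)) _ _ fun J => ?_
      have h1 : (Equiv.swap s t).arrowCongr (Equiv.refl V) J = J ∘ Equiv.swap s t := by
        funext u; simp [Equiv.arrowCongr]
      have h2 : (J ∘ Equiv.swap s t) ∘ Equiv.swap s t = J := by
        funext u; simp
      rw [h1, h2]

lemma Dop_diag (a : V) (c : (ι → V) → ℂ) (J : ι → V) :
    Dop a a c J = ((Finset.univ.filter (fun s => J s = a)).card : ℂ) * c J := by
  simp only [Dop]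
  have : ∀ s, (if J s = a then c (update J s a) else 0) = if J s = a then c J else 0 := by
    intro s
    split_ifs with h
    · rw [← h]; simp
    · rfl
  simp only [this]
  rw [← Finset.sum_filter]
  simp

lemma Aop_ker (c : (ι → V) → ℂ) (hc : Aop c = 0) :
    (∀ a b, a ≠ b → Dop a b c = 0) ∧ (∀ J, c J ≠ 0 → Injective J) := by
  let N : V → (ι → V) → ℕ := fun a J => (Finset.univ.filter (fun s => J s = a)).card
  have hN : ∀ J, ∑ a, N a J = Fintype.card ι := by
    intro J
    have := Finset.card_eq_sum_card_fiberwise (f := J) (s := Finset.univ) (t := Finset.univ)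
      (fun _ _ => by simp)
    simpa [N] using this.symm
  have hq : ∀ z : ℂ, star z * z = ((Complex.normSq z : ℝ) : ℂ) := by
    intro z
    rw [Complex.normSq_eq_conj_mul_self]; rfl
  have h1 : ∑ a, ∑ b, hform (Dop b a c) (Dop b a c) = (Fintype.card ι : ℂ) * hform c c := by
    have : ∀ a b : V, hform (Dop b a c) (Dop b a c) = hform c (Dop a b (Dop b a c)) :=
      fun a b => (adj a b c (Dop b a c)).symm
    simp only [this]
    have h2 : ∀ J, ∑ a, ∑ b, Dop a b (Dop b a c) J = (Fintype.card ι : ℂ) * c J := by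
      intro J; rw [DD_swap, hc]; simp
    simp only [hform]
    rw [Finset.mul_sum]
    calc _ = ∑ a, ∑ J, ∑ b, star (c J) * Dop a b (Dop b a c) J :=
          Finset.sum_congr rfl fun a _ => Finset.sum_comm
      _ = ∑ J, star (c J) * ∑ a, ∑ b, Dop a b (Dop b a c) J := by
          rw [Finset.sum_comm]
          simp only [Finset.mul_sum]
      _ = _ := by
          refine Finset.sum_congr rfl fun J _ => ?_
          rw [h2]; ring
  let Q : V → V → ℝ := fun a b => ∑ J, Complex.normSq (Dop b a c J)
  let T : V → V → ℝ := fun a b => Q a b -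
    if a = b then ∑ J, (N a J : ℝ) * Complex.normSq (c J) else 0
  have hQ : ∑ a, ∑ b, Q a b = (Fintype.card ι : ℝ) * ∑ J, Complex.normSq (c J) := by
    simp only [hform, hq] at h1
    exact_mod_cast h1
  have hTd : ∀ a, T a a = ∑ J, ((N a J : ℝ) * ((N a J : ℝ) - 1)) * Complex.normSq (c J) := by
    intro a
    simp only [T, Q, if_true, Dop_diag, ← Finset.sum_sub_distrib]
    refine Finset.sum_congr rfl fun J _ => ?_
    rw [Complex.normSq_mul, Complex.normSq_natCast]
    simp only [N]
    ring
  have hNN : ∀ m : ℕ, 0 ≤ (m : ℝ) * ((m : ℝ) - 1) := by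
    intro m
    rcases m with _ | m
    · simp
    · push_cast
      have : (0 : ℝ) ≤ m := Nat.cast_nonneg m
      nlinarith
  have hT0 : ∀ a b, 0 ≤ T a b := by
    intro a b
    by_cases h : a = b
    · subst h
      rw [hTd]
      exact Finset.sum_nonneg fun J _ => mul_nonneg (hNN _) (Complex.normSq_nonneg _)
    · simp only [T, Q, h, if_false, sub_zero]
      exact Finset.sum_nonneg fun J _ => Complex.normSq_nonneg _
  have hTs : ∑ a, ∑ b, T a b = 0 := by
    simp only [T, Finset.sum_sub_distrib, hQ]
    simp only [Finset.sum_ite_eq, Finset.mem_univ, if_true]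
    rw [Finset.sum_comm, Finset.mul_sum, ← Finset.sum_sub_distrib]
    refine Finset.sum_eq_zero fun J _ => ?_
    rw [← Finset.sum_mul, ← Nat.cast_sum, hN, sub_self]
  have hTz : ∀ a b, T a b = 0 := by
    intro a b
    have h2 := (Finset.sum_eq_zero_iff_of_nonneg
      (fun a _ => Finset.sum_nonneg fun b _ => hT0 a b)).1 hTs a (Finset.mem_univ _)
    exact (Finset.sum_eq_zero_iff_of_nonneg (fun b _ => hT0 a b)).1 h2 b (Finset.mem_univ _)
  constructor
  · intro a b hab
    have := hTz b a
    simp only [T, Q, hab.symm, if_false, sub_zero] at this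
    rw [Finset.sum_eq_zero_iff_of_nonneg (fun _ _ => Complex.normSq_nonneg _)] at this
    funext J
    simpa using this J (Finset.mem_univ _)
  · intro J hJ s t hst
    have := hTz (J s) (J s)
    rw [hTd, Finset.sum_eq_zero_iff_of_nonneg
      (fun J _ => mul_nonneg (hNN _) (Complex.normSq_nonneg _))] at this
    have h3 := this J (Finset.mem_univ _)
    have hcJ : Complex.normSq (c J) ≠ 0 := by simpa using hJ
    have h4 : (N (J s) J : ℝ) * ((N (J s) J : ℝ) - 1) = 0 := by
      rcases mul_eq_zero.1 h3 with h | h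
      · exact h
      · exact absurd h hcJ
    have hpos : 0 < N (J s) J := Finset.card_pos.2 ⟨s, by simp⟩
    have h5 : N (J s) J = 1 := by
      rcases mul_eq_zero.1 h4 with h | h
      · have : N (J s) J = 0 := by exact_mod_cast h
        omega
      · have : (N (J s) J : ℝ) = 1 := by linarith
        exact_mod_cast this
    exact Finset.card_le_one.1 h5.le s (by simp) t (by simp [hst])

lemma swap_antisymm (c : (ι → V) → ℂ) (hD : ∀ a b, a ≠ b → Dop a b c = 0)
    (hinj : ∀ J, c J ≠ 0 → Injective J) [Nonempty ι] :
    (∀ J, c J ≠ 0 → Bijective J) ∧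
    (∀ (τ : Equiv.Perm V) (J : ι → V), c (τ ∘ J) = ((Equiv.Perm.sign τ : ℤ) : ℂ) * c J) := by
  have hbij : ∀ J, c J ≠ 0 → Bijective J := by
    intro J hJ
    refine ⟨hinj J hJ, ?_⟩
    by_contra hs
    simp only [Surjective, not_forall, not_exists] at hs
    obtain ⟨a, ha⟩ := hs
    obtain ⟨s⟩ := ‹Nonempty ι›
    have h := congrFun (hD a (J s) (fun e => ha s e.symm)) (update J s a)
    simp only [Dop, Pi.zero_apply] at h
    rw [Finset.sum_eq_single s] at h
    · simp at h; exact hJ h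
    · intro t _ hts
      simp [hts, ha t]
    · simp
  refine ⟨hbij, ?_⟩
  have hsw : ∀ a b : V, a ≠ b → ∀ J : ι → V, Bijective J → c (Equiv.swap a b ∘ J) = - c J := by
    intro a b hab J hJ
    obtain ⟨s, hs⟩ := hJ.2 a
    obtain ⟨t, ht⟩ := hJ.2 b
    have hst : s ≠ t := by rintro rfl; exact hab (hs.symm.trans ht)
    have h := congrFun (hD b a hab.symm) (update J s b)
    simp only [Dop, Pi.zero_apply] at h
    rw [Finset.sum_eq_add s t hst] at h
    · have h1 : update (update J s b) s a = J := by rw [← hs]; simp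
      have h2 : update (update J s b) t a = Equiv.swap a b ∘ J := by
        funext u
        by_cases hu : u = t
        · subst hu; simp [ht]
        · by_cases hu2 : u = s
          · subst hu2; simp [hu, hs]
          · have e1 : J u ≠ a := fun e => hu2 (hJ.1 (e.trans hs.symm))
            have e2 : J u ≠ b := fun e => hu (hJ.1 (e.trans ht.symm))
            simp [hu, hu2, Equiv.swap_apply_of_ne_of_ne e1 e2]
      have h3 : update J s b t = b := by rw [update_of_ne hst.symm, ht]
      rw [h3, h1, h2] at h
      simp at h
      linear_combination h
    · intro u _ hu
      have : J u ≠ b := fun e => hu.2 (hJ.1 (e.trans ht.symm))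
      simp [hu.1, this]
    · simp
    · simp
  have hz : ∀ J : ι → V, ¬ Bijective J → c J = 0 := by
    intro J h; by_contra h2; exact h (hbij J h2)
  intro τ
  induction τ using Equiv.Perm.swap_induction_on with
  | one => intro J; simp
  | swap_mul g a b hab ih =>
    intro J
    by_cases hJ : Bijective J
    · have h1 : ⇑(Equiv.swap a b * g) ∘ J = Equiv.swap a b ∘ (g ∘ J) := by
        funext u; simp
      rw [h1, hsw a b hab _ (g.bijective.comp hJ), ih]
      simp [Equiv.Perm.sign_swap hab]
    · have h2 : ¬ Bijective (⇑(Equiv.swap a b * g) ∘ J) := by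
        intro h
        apply hJ
        exact (Equiv.comp_bijective J (Equiv.swap a b * g)).1 h
      rw [hz _ h2, hz _ hJ, mul_zero]

lemma orth_decomp {X : Type} [Fintype X] (W : Submodule ℂ (X → ℂ)) (c : X → ℂ) :
    ∃ w ∈ W, ∃ w', c = w + w' ∧ ∀ u ∈ W, hform u w' = 0 := by
  let L := WithLp.linearEquiv 2 ℂ (X → ℂ)
  let W' : Submodule ℂ (EuclideanSpace ℂ X) := W.comap L.toLinearMap
  obtain ⟨y, hy, z, hz, h⟩ := Submodule.exists_add_mem_mem_orthogonal (K := W') (L.symm c)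
  refine ⟨L y, hy, L z, ?_, ?_⟩
  · rw [← map_add, ← h]; simp
  · intro u hu
    have h2 := (Submodule.mem_orthogonal W' z).1 hz (L.symm u) (by simpa [W'] using hu)
    rw [PiLp.inner_apply] at h2
    simp only [hform]
    rw [← h2]
    refine Finset.sum_congr rfl fun J _ => ?_
    simp [L, mul_comm]

/-- Main criterion: a subspace stable under the Casimir operator and containing its kernel
contains every tensor whose image is in the subspace. -/
lemma mem_of_Aop_mem (W : Submodule ℂ ((ι → V) → ℂ)) (hA : ∀ c ∈ W, Aop c ∈ W)
    (hker : ∀ c, Aop c = 0 → c ∈ W) (c : (ι → V) → ℂ) (hc : Aop c ∈ W) : c ∈ W := by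
  obtain ⟨w, hw, w', rfl, hw'⟩ := orth_decomp W c
  have hadd : Aop (w + w') = Aop w + Aop w' := by
    funext J
    have : ∀ s t : ι, (if s = t then (0:ℂ) else w (J ∘ Equiv.swap s t) + w' (J ∘ Equiv.swap s t))
      = (if s = t then 0 else w (J ∘ Equiv.swap s t)) +
        (if s = t then 0 else w' (J ∘ Equiv.swap s t)) := by
      intro s t; split_ifs <;> simp
    simp only [Aop, Pi.add_apply, this, Finset.sum_add_distrib]
    ring
  have h1 : Aop w' ∈ W := by
    rw [hadd] at hc
    exact (Submodule.add_mem_iff_right W (hA w hw)).1 hc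
  have h2 : Aop w' = 0 := by
    apply hform_self_eq_zero
    rw [Aop_symm]
    exact hw' _ (hA _ h1)
  exact W.add_mem hw (hker _ h2)

end Casimir
end SOInv


namespace SOInv
section Traces

variable {V α : Type} [Fintype V] [DecidableEq V]

/-- product of the matrices along a list -/
def word (l : List α) (X : α → Matrix V V ℂ) : Matrix V V ℂ := (l.map X).prod

/-- product of traces of a list of words -/
def Tr (t : List (List α)) (X : α → Matrix V V ℂ) : ℂ :=
  (t.map fun l => Matrix.trace (word l X)).prod

lemma prod_ofFn_entry (m : ℕ) (g : Fin (m + 1) → Matrix V V ℂ) (p q : V) :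
    (List.ofFn g).prod p q = ∑ j : Fin m → V, ∏ i : Fin (m + 1),
      g i ((Fin.cons p j : Fin (m + 1) → V) i) ((Fin.snoc j q : Fin (m + 1) → V) i) := by
  induction m generalizing p with
  | zero => simp [Fin.snoc]
  | succ m ih =>
    rw [List.ofFn_succ, List.prod_cons, Matrix.mul_apply]
    rw [← (Fin.consEquiv (fun _ => V)).sum_comp, Fintype.sum_prod_type]
    refine Finset.sum_congr rfl fun x _ => ?_
    rw [ih (fun i => g i.succ), Finset.mul_sum]
    refine Finset.sum_congr rfl fun j _ => ?_
    rw [Fin.prod_univ_succ (n := m + 1)]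
    have h0 : (Fin.snoc (Fin.cons x j : Fin (m + 1) → V) q : Fin (m + 2) → V)
        = Fin.cons x (Fin.snoc j q : Fin (m + 1) → V) :=
      (Fin.cons_snoc_eq_snoc_cons (β := V) x j q).symm
    simp only [Fin.consEquiv, Equiv.coe_fn_mk, Fin.cons_zero, Fin.cons_succ]
    rw [h0]
    simp

lemma trace_ofFn (m : ℕ) (g : Fin (m + 1) → Matrix V V ℂ) :
    Matrix.trace (List.ofFn g).prod = ∑ j : Fin (m + 1) → V, ∏ i : Fin (m + 1),
      g i (j i) (j (finRotate (m + 1) i)) := by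
  rw [← (Fin.consEquiv (fun _ => V)).sum_comp, Fintype.sum_prod_type]
  simp only [Matrix.trace, Matrix.diag]
  refine Finset.sum_congr rfl fun p _ => ?_
  rw [prod_ofFn_entry]
  refine Finset.sum_congr rfl fun j _ => Finset.prod_congr rfl fun i _ => ?_
  simp only [Fin.consEquiv, Equiv.coe_fn_mk]
  congr 1
  induction i using Fin.lastCases with
  | last => simp
  | cast i => simp [Fin.cons, Fin.snoc]

lemma trace_word (l : List α) (hl : l ≠ []) :
    ∃ ρ : Equiv.Perm (Fin l.length), ∀ X : α → Matrix V V ℂ,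
      Matrix.trace (word l X) = ∑ j : Fin l.length → V, ∏ i, X (l.get i) (j i) (j (ρ i)) := by
  obtain ⟨a, l, rfl⟩ := List.exists_cons_of_ne_nil hl
  refine ⟨finRotate (l.length + 1), fun X => ?_⟩
  have := trace_ofFn l.length (fun i : Fin (l.length + 1) => X ((a :: l).get i))
  have h2 : List.ofFn (fun i : Fin (l.length + 1) => X ((a :: l).get i)) = (a :: l).map X := by
    conv_rhs => rw [← List.ofFn_get (a :: l), List.map_ofFn]
    rfl
  rw [h2] at this
  exact this

lemma Tr_eq_perm {β : Type} [Fintype β] [DecidableEq β] (v : β → α) (hv : Injective v)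
    (t : List (List α)) (hne : ∀ l ∈ t, l ≠ []) (hnd : t.flatten.Nodup)
    (hcov : ∀ x, x ∈ t.flatten ↔ ∃ b, v b = x) :
    ∃ σ : Equiv.Perm β, ∀ X : α → Matrix V V ℂ,
      Tr t X = ∑ j : β → V, ∏ i, X (v i) (j i) (j (σ i)) := by
  have hget : ∀ c : Fin t.length, t.get c ∈ t := fun c => List.get_mem t c
  choose ρ hρ using fun c : Fin t.length => trace_word (V := V) (t.get c) (hne _ (hget c))
  have hex : ∀ p : (Σ c : Fin t.length, Fin (t.get c).length),
      ∃ b, v b = (t.get p.1).get p.2 := fun p =>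
    (hcov _).1 (List.mem_flatten.2 ⟨t.get p.1, hget _, List.get_mem _ _⟩)
  choose g hg using hex
  rw [List.nodup_flatten] at hnd
  have hbij : Bijective g := by
    constructor
    · rintro ⟨c, i⟩ ⟨c', i'⟩ h
      have h1 : (t.get c).get i = (t.get c').get i' := by
        rw [← hg ⟨c, i⟩, ← hg ⟨c', i'⟩, h]
      have hcc : c = c' := by
        by_contra hne
        have hp := List.pairwise_iff_get.1 hnd.2
        rcases lt_or_gt_of_ne hne with hlt | hlt
        · exact hp c c' hlt (List.get_mem _ i) (h1 ▸ List.get_mem _ i')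
        · exact hp c' c hlt (List.get_mem _ i') (h1 ▸ List.get_mem _ i)
      subst hcc
      have := (hnd.1 _ (hget c)).injective_get h1
      rw [this]
    · intro b
      obtain ⟨l, hl, hb⟩ := List.mem_flatten.1 ((hcov (v b)).2 ⟨b, rfl⟩)
      obtain ⟨c, rfl⟩ := List.mem_iff_get.1 hl
      obtain ⟨i, hi⟩ := List.mem_iff_get.1 hb
      exact ⟨⟨c, i⟩, hv ((hg _).trans hi)⟩
  let e := Equiv.ofBijective g hbij
  refine ⟨(e.symm.trans (Equiv.sigmaCongrRight ρ)).trans e, fun X => ?_⟩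
  have h1 : Tr t X = ∏ c : Fin t.length, Matrix.trace (word (t.get c) X) := by
    rw [Tr, ← List.prod_ofFn]
    congr 1
    conv_lhs => rw [← List.ofFn_get t, List.map_ofFn]
    rfl
  rw [h1]
  simp only [hρ]
  rw [Finset.prod_univ_sum]
  rw [← (e.arrowCongr (Equiv.refl V)).sum_comp]
  rw [← (Equiv.piCurry (fun (c : Fin t.length) (_ : Fin (t.get c).length) => V)).symm.sum_comp]
  simp only [Fintype.piFinset_univ]
  refine Finset.sum_congr rfl fun j _ => ?_
  rw [← e.prod_comp, Fintype.prod_sigma]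
  refine Finset.prod_congr rfl fun c _ => Finset.prod_congr rfl fun i _ => ?_
  have h2 : v (e ⟨c, i⟩) = (t.get c).get i := hg ⟨c, i⟩
  rw [h2]
  have h3 : ∀ p, j (e.symm (e p)).fst (e.symm (e p)).snd = j p.1 p.2 := by
    intro p; rw [Equiv.symm_apply_apply]
  simp [Equiv.arrowCongr, Equiv.piCurry, Sigma.uncurry, h3]

lemma word_transpose (X : α → Matrix V V ℂ) (hX : ∀ i, (X i).transpose = - X i) (l : List α) :
    (word l X).transpose = (-1 : ℂ) ^ l.length • word l.reverse X := by
  induction l with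
  | nil => simp [word]
  | cons a l ih =>
    have h1 : word (a :: l) X = X a * word l X := by simp [word]
    have h2 : word (a :: l).reverse X = word l.reverse X * X a := by simp [word]
    rw [h1, h2, Matrix.transpose_mul, ih, hX]
    simp [pow_succ]

lemma word_append (X : α → Matrix V V ℂ) (l l' : List α) :
    word (l ++ l') X = word l X * word l' X := by simp [word]

end Traces
end SOInv

namespace SOInv
section Chains

variable {V α : Type} [Fintype V] [DecidableEq V]

/-- extend an index function by two values -/
def ext2 {ι : Type} (x y : V) (J : ι → V) : Option (Option ι) → V :=
  fun o => o.elim x (fun o' => o'.elim y J)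

lemma sum_option_fun {ι : Type} [Fintype ι] [DecidableEq ι] (F : (Option ι → V) → ℂ) :
    ∑ I, F I = ∑ x, ∑ J : ι → V, F (fun o => o.elim x J) := by
  rw [← (Equiv.piOptionEquivProd (β := fun _ : Option ι => V)).symm.sum_comp,
    Fintype.sum_prod_type]
  refine Finset.sum_congr rfl fun x _ => Finset.sum_congr rfl fun J _ => ?_
  congr 1
  funext o
  cases o <;> rfl

lemma sum_ext2 {ι ι' : Type} [Fintype ι] [DecidableEq ι] [Fintype ι'] [DecidableEq ι']
    (e : Option (Option ι') ≃ ι) (F : (ι → V) → ℂ) :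
    ∑ I, F I = ∑ x, ∑ y, ∑ J : ι' → V, F (ext2 x y J ∘ e.symm) := by
  rw [← (e.arrowCongr (Equiv.refl V)).sum_comp, sum_option_fun]
  refine Finset.sum_congr rfl fun x _ => ?_
  rw [sum_option_fun]
  rfl

/-- contraction of two slots -/
def contr {ι ι' : Type} (e : Option (Option ι') ≃ ι) (c : (ι → V) → ℂ) : (ι' → V) → ℂ :=
  fun J => ∑ x, c (ext2 x x J ∘ e.symm)

lemma update_comp_symm {ι ι' : Type} [DecidableEq ι] [DecidableEq ι'] (e : ι' ≃ ι)
    (J : ι' → V) (u : ι') (b : V) : update (J ∘ e.symm) (e u) b = update J u b ∘ e.symm := by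
  funext z
  by_cases h : z = e u
  · subst h; simp
  · have : e.symm z ≠ u := by rintro rfl; simp at h
    simp [h, this]

lemma ext2_update0 {ι : Type} [DecidableEq ι] (x y b : V) (J : ι → V) :
    update (ext2 x y J) none b = ext2 b y J := by
  funext o; rcases o with _ | _ | o <;> simp [ext2]

lemma ext2_update1 {ι : Type} [DecidableEq ι] (x y b : V) (J : ι → V) :
    update (ext2 x y J) (some none) b = ext2 x b J := by
  funext o; rcases o with _ | _ | o <;> simp [ext2]

lemma ext2_update2 {ι : Type} [DecidableEq ι] (x y b : V) (J : ι → V) (s : ι) :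
    update (ext2 x y J) (some (some s)) b = ext2 x y (update J s b) := by
  funext o
  rcases o with _ | _ | o
  · simp [ext2]
  · simp [ext2]
  · by_cases h : o = s
    · subst h; simp [ext2]
    · simp [ext2, h]

lemma inv_contr {ι ι' : Type} [Fintype ι] [DecidableEq ι] [Fintype ι'] [DecidableEq ι']
    (e : Option (Option ι') ≃ ι) (c : (ι → V) → ℂ) (hc : Inv c) : Inv (contr e c) := by
  have key : ∀ a b J, ∑ x, Dop a b c (ext2 x x J ∘ e.symm) =
      c (ext2 b a J ∘ e.symm) + c (ext2 a b J ∘ e.symm) + Dop a b (contr e c) J := by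
    intro a b J
    have h1 : ∀ x, Dop a b c (ext2 x x J ∘ e.symm) =
      (if x = a then c (ext2 b x J ∘ e.symm) else 0) +
      ((if x = a then c (ext2 x b J ∘ e.symm) else 0) +
        ∑ s, if J s = a then c (ext2 x x (update J s b) ∘ e.symm) else 0) := by
      intro x
      rw [Dop, ← e.sum_comp, Fintype.sum_option, Fintype.sum_option]
      simp only [update_comp_symm, ext2_update0, ext2_update1, ext2_update2, comp_apply,
        Equiv.symm_apply_apply]
      rfl
    simp only [h1, Finset.sum_add_distrib]
    rw [Finset.sum_comm]
    simp only [Finset.sum_ite_eq', Finset.mem_univ, if_true, Dop, contr, add_assoc]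
    congr 2
    refine Finset.sum_congr rfl fun s _ => ?_
    split_ifs <;> simp
  intro a b
  funext J
  have h1 := key a b J
  have h2 := key b a J
  rw [hc a b, h2] at h1
  linear_combination -h1

/-- value of a tensor on a family of chains -/
def Phi {κ : Type} [Fintype κ] [DecidableEq κ] (c : (κ × Bool → V) → ℂ) (w : κ → List α)
    (X : α → Matrix V V ℂ) : ℂ :=
  ∑ I : κ × Bool → V, c I * ∏ d, word (w d) X (I (d, false)) (I (d, true))

lemma Phi_K {κ ι' : Type} [Fintype κ] [DecidableEq κ] [Fintype ι'] [DecidableEq ι']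
    (e : Option (Option ι') ≃ κ × Bool) (c : (κ × Bool → V) → ℂ) (w : κ → List α)
    (X : α → Matrix V V ℂ) :
    Phi (Kop (e none) (e (some none)) c) w X = ∑ J : ι' → V, contr e c J *
      ∑ x, ∏ d, word (w d) X (ext2 x x J (e.symm (d, false))) (ext2 x x J (e.symm (d, true))) := by
  rw [Phi, sum_ext2 e]
  have h : ∀ x y (J : ι' → V), Kop (e none) (e (some none)) c (ext2 x y J ∘ e.symm) =
      if x = y then contr e c J else 0 := by
    intro x y J
    simp only [Kop, update_comp_symm, ext2_update0, ext2_update1]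
    simp [ext2, contr]
  simp only [h, ite_mul, zero_mul]
  have : ∀ x, ∑ y, ∑ J : ι' → V, (if x = y then contr e c J *
      ∏ d, word (w d) X ((ext2 x y J ∘ e.symm) (d, false)) ((ext2 x y J ∘ e.symm) (d, true))
        else 0) = ∑ J : ι' → V, contr e c J *
      ∏ d, word (w d) X ((ext2 x x J ∘ e.symm) (d, false)) ((ext2 x x J ∘ e.symm) (d, true)) := by
    intro x
    rw [Finset.sum_comm]
    simp
  simp only [this]
  rw [Finset.sum_comm]
  simp only [Finset.mul_sum, comp_apply]

/-- slot bijection for closing up a single chain -/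
def slotEquiv1 (κ : Type) (x : Bool) : Option (Option (κ × Bool)) ≃ Option κ × Bool where
  toFun o := match o with
    | none => (none, x)
    | some none => (none, !x)
    | some (some (d, z)) => (some d, z)
  invFun p := match p with
    | (none, z) => if z = x then none else some none
    | (some d, z) => some (some (d, z))
  left_inv := by
    rintro (_ | _ | ⟨d, z⟩) <;> simp
  right_inv := by
    rintro ⟨_ | d, z⟩
    · cases x <;> cases z <;> simp
    · simp

/-- slot bijection for joining two chains -/
def slotEquiv2 (κ : Type) (x y : Bool) :
    Option (Option (Option κ × Bool)) ≃ Option (Option κ) × Bool where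
  toFun o := match o with
    | none => (none, x)
    | some none => (some none, y)
    | some (some (none, false)) => (none, !x)
    | some (some (none, true)) => (some none, !y)
    | some (some (some d, z)) => (some (some d), z)
  invFun p := match p with
    | (none, z) => if z = x then none else some (some (none, false))
    | (some none, z) => if z = y then some none else some (some (none, true))
    | (some (some d), z) => some (some (some d, z))
  left_inv := by
    rintro (_ | _ | ⟨_ | d, _ | _⟩) <;> simp
  right_inv := by
    rintro ⟨_ | _ | d, z⟩
    · cases x <;> cases z <;> simp
    · cases y <;> cases z <;> simp
    · simp

lemma Phi_close {κ κ' : Type} [Fintype κ] [DecidableEq κ] [Fintype κ'] [DecidableEq κ']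
    (ψ : Option κ' ≃ κ) (x : Bool) (c : (κ × Bool → V) → ℂ) (w : κ → List α)
    (X : α → Matrix V V ℂ) :
    Phi (Kop (ψ none, x) (ψ none, !x) c) w X =
      Matrix.trace (word (w (ψ none)) X) *
      Phi (contr ((slotEquiv1 κ' x).trans (ψ.prodCongr (Equiv.refl Bool))) c)
        (fun d => w (ψ (some d))) X := by
  have := Phi_K ((slotEquiv1 κ' x).trans (ψ.prodCongr (Equiv.refl Bool))) c w X
  have e1 : ((slotEquiv1 κ' x).trans (ψ.prodCongr (Equiv.refl Bool))) none = (ψ none, x) := rfl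
  have e2 : ((slotEquiv1 κ' x).trans (ψ.prodCongr (Equiv.refl Bool))) (some none)
    = (ψ none, !x) := rfl
  rw [e1, e2] at this
  rw [this, Phi, Finset.mul_sum]
  refine Finset.sum_congr rfl fun J _ => ?_
  rw [mul_left_comm]
  congr 1
  simp only [Matrix.trace, Matrix.diag, Finset.sum_mul]
  refine Finset.sum_congr rfl fun y _ => ?_
  rw [← ψ.prod_comp, Fintype.prod_option]
  congr 1
  · cases x <;> simp [slotEquiv1, ext2]
  · simp [slotEquiv1, ext2]

/-- reversed list if the flag is set -/
def flip (x : Bool) (l : List α) : List α := if x then l.reverse else l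

lemma Phi_join {κ κ' : Type} [Fintype κ] [DecidableEq κ] [Fintype κ'] [DecidableEq κ']
    (ψ : Option (Option κ') ≃ κ) (x y : Bool) (c : (κ × Bool → V) → ℂ) (w : κ → List α) :
    ∃ z : ℂ, ∀ (X : α → Matrix V V ℂ), (∀ i, (X i).transpose = - X i) →
    Phi (Kop (ψ none, x) (ψ (some none), y) c) w X = z *
      Phi (contr ((slotEquiv2 κ' x y).trans (ψ.prodCongr (Equiv.refl Bool))) c)
        (fun d => d.elim (flip (!x) (w (ψ none)) ++ flip y (w (ψ (some none))))
          fun d' => w (ψ (some (some d')))) X := by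
  refine ⟨(if x then 1 else (-1) ^ (w (ψ none)).length) *
    (if y then (-1) ^ (w (ψ (some none))).length else 1), fun X hX => ?_⟩
  have := Phi_K ((slotEquiv2 κ' x y).trans (ψ.prodCongr (Equiv.refl Bool))) c w X
  have e1 : ((slotEquiv2 κ' x y).trans (ψ.prodCongr (Equiv.refl Bool))) none = (ψ none, x) := rfl
  have e2 : ((slotEquiv2 κ' x y).trans (ψ.prodCongr (Equiv.refl Bool))) (some none)
    = (ψ (some none), y) := rfl
  rw [e1, e2] at this
  rw [this, Phi, Finset.mul_sum]
  refine Finset.sum_congr rfl fun J _ => ?_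
  rw [mul_left_comm]
  congr 1
  have hT : ∀ (l : List α) (p q : V), word l X p q = (-1) ^ l.length * word l.reverse X q p := by
    intro l p q
    have := congrFun (congrFun (word_transpose X hX l) q) p
    simpa [Matrix.transpose_apply] using this
  rw [Fintype.prod_option]
  simp only [Option.elim, word_append, Matrix.mul_apply]
  rw [← mul_assoc, Finset.mul_sum, Finset.sum_mul]
  refine Finset.sum_congr rfl fun v _ => ?_
  rw [← ψ.prod_comp, Fintype.prod_option, Fintype.prod_option, ← mul_assoc]
  congr 1
  · cases x <;> cases y
    · simp [slotEquiv2, ext2, flip]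
      rw [hT (w (ψ none)) v]; ring
    · simp [slotEquiv2, ext2, flip]
      rw [hT (w (ψ none)) v, hT (w (ψ (some none))) _ v]; ring
    · simp [slotEquiv2, ext2, flip]
    · simp [slotEquiv2, ext2, flip]
      rw [hT (w (ψ (some none))) _ v]; ring
  · simp [slotEquiv2, ext2]

end Chains
end SOInv

namespace SOInv
section Main

variable {V α Ω : Type} [Fintype V] [DecidableEq V] [Fintype α]

lemma inv_perm {ι : Type} [Fintype ι] [DecidableEq ι] (π : Equiv.Perm ι) (c : (ι → V) → ℂ)
    (hc : Inv c) : Inv (fun I => c (I ∘ π)) := by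
  have h : ∀ a b J, Dop a b (fun I => c (I ∘ π)) J = Dop a b c (J ∘ π) := by
    intro a b J
    simp only [Dop]
    rw [← Equiv.sum_comp π]
    refine Finset.sum_congr rfl fun s _ => ?_
    have : update J (π s) b ∘ π = update (J ∘ π) s b := by
      have := update_comp_symm π.symm J (π s) b
      simpa using this.symm
    rw [this]; rfl
  intro a b
  funext J
  rw [h, h, hc a b]

lemma Kop_perm {ι : Type} [Fintype ι] [DecidableEq ι] (π : Equiv.Perm ι) (c : (ι → V) → ℂ)
    (s t : ι) : (fun I => Kop s t c (I ∘ π)) = Kop (π s) (π t) (fun I => c (I ∘ π)) := by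
  have h : ∀ (J : ι → V) s b, update J (π s) b ∘ π = update (J ∘ π) s b := by
    intro J s b
    have := update_comp_symm π.symm J (π s) b
    simpa using this.symm
  funext I
  simp only [Kop, h, comp_apply]

variable {κ : Type} [Fintype κ] [DecidableEq κ]

lemma Phi_add (c c' : (κ × Bool → V) → ℂ) (w : κ → List α) (X : α → Matrix V V ℂ) :
    Phi (c + c') w X = Phi c w X + Phi c' w X := by
  simp [Phi, add_mul, Finset.sum_add_distrib]

lemma Phi_smul (z : ℂ) (c : (κ × Bool → V) → ℂ) (w : κ → List α) (X : α → Matrix V V ℂ) :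
    Phi (z • c) w X = z * Phi c w X := by
  simp [Phi, mul_assoc, Finset.mul_sum]

lemma Phi_zero (w : κ → List α) (X : α → Matrix V V ℂ) :
    Phi (0 : (κ × Bool → V) → ℂ) w X = 0 := by
  simp [Phi]

/-- all evaluations of the tensor on chains lie in the target space -/
def Good (Sp : Submodule ℂ (Ω → ℂ)) (X : Ω → α → Matrix V V ℂ)
    (c : (κ × Bool → V) → ℂ) : Prop :=
  ∀ (w : κ → List α) (t : List (List α)), (∀ d, w d ≠ []) → (∀ l ∈ t, l ≠ []) →
    (∑ d, (w d : Multiset α)) + (t.flatten : Multiset α) = (Finset.univ : Finset α).val →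
    (fun ω => Phi c w (X ω) * Tr t (X ω)) ∈ Sp

lemma Good.add {Sp : Submodule ℂ (Ω → ℂ)} {X : Ω → α → Matrix V V ℂ}
    {c c' : (κ × Bool → V) → ℂ} (h : Good Sp X c) (h' : Good Sp X c') : Good Sp X (c + c') := by
  intro w t h1 h2 h3
  have := Sp.add_mem (h w t h1 h2 h3) (h' w t h1 h2 h3)
  simp only [Phi_add, add_mul]
  exact this

lemma Good.smul {Sp : Submodule ℂ (Ω → ℂ)} {X : Ω → α → Matrix V V ℂ} (z : ℂ)
    {c : (κ × Bool → V) → ℂ} (h : Good Sp X c) : Good Sp X (z • c) := by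
  intro w t h1 h2 h3
  have := Sp.smul_mem z (h w t h1 h2 h3)
  simp only [Phi_smul, mul_assoc]
  exact this

lemma Good.zero {Sp : Submodule ℂ (Ω → ℂ)} {X : Ω → α → Matrix V V ℂ} :
    Good Sp X (0 : (κ × Bool → V) → ℂ) := by
  intro w t h1 h2 h3
  simp only [Phi_zero, zero_mul]
  exact Sp.zero_mem

/-- The permutation-stable subspace of good tensors. -/
def goodSub (κ : Type) [Fintype κ] [DecidableEq κ]
    (Sp : Submodule ℂ (Ω → ℂ)) (X : Ω → α → Matrix V V ℂ) :
    Submodule ℂ ((κ × Bool → V) → ℂ) where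
  carrier := {c | ∀ π : Equiv.Perm (κ × Bool), Good Sp X (fun I => c (I ∘ π))}
  add_mem' := fun h h' π => (h π).add (h' π)
  zero_mem' := fun _ => Good.zero
  smul_mem' := fun z _ h π => (h π).smul z

lemma goodSub_Aop (Sp : Submodule ℂ (Ω → ℂ)) (X : Ω → α → Matrix V V ℂ)
    (c : (κ × Bool → V) → ℂ) (hc : c ∈ goodSub κ Sp X) : Aop c ∈ goodSub κ Sp X := by
  have h : Aop c = ((Fintype.card (κ × Bool) : ℂ) * ((Fintype.card V : ℂ) - 1)) • c +
      ∑ s : κ × Bool, ∑ t : κ × Bool, if s = t then 0 else fun J => c (J ∘ Equiv.swap s t) := by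
    funext J
    simp only [Aop, Pi.add_apply, Pi.smul_apply, smul_eq_mul, Finset.sum_apply]
    congr 1
    refine Finset.sum_congr rfl fun s _ => Finset.sum_congr rfl fun t _ => ?_
    split_ifs <;> rfl
  rw [h]
  refine Submodule.add_mem _ (Submodule.smul_mem _ _ hc) ?_
  refine Submodule.sum_mem _ fun s _ => Submodule.sum_mem _ fun t _ => ?_
  split_ifs
  · exact Submodule.zero_mem _
  · intro π
    exact hc (π * Equiv.swap s t)

/-- the index `i` in the first half -/
def lowIdx {r : ℕ} (i : Fin r) : Fin (2 * r) := Fin.castLE (Nat.le_mul_of_pos_left r two_pos) i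

/-- the index `r + i` in the second half -/
def highIdx {r : ℕ} (i : Fin r) : Fin (2 * r) := Fin.cast (two_mul r).symm (Fin.natAdd r i)

lemma Phi_antisymm {r : ℕ} (φ : κ ≃ Fin r) (c : (κ × Bool → Fin (2 * r)) → ℂ)
    (hb : ∀ J, c J ≠ 0 → Bijective J)
    (hs : ∀ (τ : Equiv.Perm (Fin (2 * r))) (J : κ × Bool → Fin (2 * r)),
      c (τ ∘ J) = ((Equiv.Perm.sign τ : ℤ) : ℂ) * c J) (w : κ → List α) :
    ∃ z : ℂ, ∀ X : α → Matrix (Fin (2 * r)) (Fin (2 * r)) ℂ, Phi c w X = z *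
      ∑ τ : Equiv.Perm (Fin (2 * r)), ((Equiv.Perm.sign τ : ℤ) : ℂ) *
        ∏ i : Fin r, word (w (φ.symm i)) X
          (τ (lowIdx i)) (τ (highIdx i)) := by
  let g : κ × Bool → Fin (2 * r) := fun p =>
    if p.2 then highIdx (φ p.1) else lowIdx (φ p.1)
  have hg : Bijective g := by
    rw [Fintype.bijective_iff_injective_and_card]
    constructor
    · rintro ⟨d, b⟩ ⟨d', b'⟩ h
      have h1 := (φ d).2
      have h2 := (φ d').2
      cases b <;> cases b' <;> simp [g, lowIdx, highIdx, Fin.ext_iff] at h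
      · have : φ d = φ d' := Fin.ext h
        simp [φ.injective this]
      · omega
      · omega
      · have : φ d = φ d' := Fin.ext h
        simp [φ.injective this]
    · simp [Fintype.card_congr φ]; ring
  refine ⟨c g, fun X => ?_⟩
  rw [Phi, Finset.mul_sum]
  symm
  refine Fintype.sum_of_injective (fun τ : Equiv.Perm (Fin (2 * r)) => τ ∘ g) ?_ _ _ ?_ ?_
  · intro τ τ' h
    ext1 v
    obtain ⟨u, rfl⟩ := hg.2 v
    exact congrFun h u
  · intro J hJ
    by_cases h : c J = 0
    · rw [h, zero_mul]
    · exfalso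
      apply hJ
      have hJb := hb J h
      refine ⟨(Equiv.ofBijective g hg).symm.trans (Equiv.ofBijective J hJb), ?_⟩
      funext u
      have : (Equiv.ofBijective g hg).symm (g u) = u :=
        (Equiv.ofBijective g hg).symm_apply_apply u
      simp [this]
  · intro τ
    rw [hs, ← φ.symm.prod_comp]
    simp [g]
    ring

variable {r : ℕ}

theorem main_induction (Sp : Submodule ℂ (Ω → ℂ))
    (X : Ω → α → Matrix (Fin (2 * r)) (Fin (2 * r)) ℂ)
    (hX : ∀ ω i, (X ω i).transpose = - X ω i)
    (H1 : ∀ t : List (List α), (∀ l ∈ t, l ≠ []) →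
      (t.flatten : Multiset α) = (Finset.univ : Finset α).val → (fun ω => Tr t (X ω)) ∈ Sp)
    (H2 : ∀ (w : Fin r → List α) (t : List (List α)), (∀ d, w d ≠ []) → (∀ l ∈ t, l ≠ []) →
      (∑ d, (w d : Multiset α)) + (t.flatten : Multiset α) = (Finset.univ : Finset α).val →
      (fun ω => (∑ τ : Equiv.Perm (Fin (2 * r)), ((Equiv.Perm.sign τ : ℤ) : ℂ) *
        ∏ i : Fin r, word (w i) (X ω)
          (τ (lowIdx i)) (τ (highIdx i)))
          * Tr t (X ω)) ∈ Sp) (N : ℕ) :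
    ∀ (κ : Type) [Fintype κ] [DecidableEq κ], Fintype.card κ = N →
      ∀ c : (κ × Bool → Fin (2 * r)) → ℂ, Inv c → Good Sp X c := by
  induction N with
  | zero =>
    intro κ _ _ hκ c _ w t hw ht hwt
    have : IsEmpty κ := Fintype.card_eq_zero_iff.1 hκ
    have h : (fun ω => Phi c w (X ω) * Tr t (X ω)) = c default • fun ω => Tr t (X ω) := by
      funext ω
      simp [Phi]
    rw [h]
    refine Sp.smul_mem _ (H1 t ht ?_)
    simpa using hwt
  | succ N ih =>
    intro κ _ _ hκ c hc
    have hne : Nonempty κ := Fintype.card_pos_iff.1 (by omega)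
    -- contraction step
    have hK : ∀ (c : (κ × Bool → Fin (2 * r)) → ℂ), Inv c → ∀ s t, s ≠ t →
        Good Sp X (Kop s t c) := by
      rintro c hc ⟨a, x⟩ ⟨b, y⟩ hst w t hw ht hwt
      by_cases hab : a = b
      · subst hab
        have hy : y = !x := by
          cases x <;> cases y <;> simp at hst ⊢
        subst hy
        let ψ := Equiv.optionSubtypeNe a
        have hψ : ψ none = a := by simp [ψ]
        have hcard : Fintype.card {d // d ≠ a} = N := by
          have := Fintype.card_congr ψ
          rw [Fintype.card_option] at this
          omega
        have key := ih {d // d ≠ a} hcard _ (inv_contr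
          ((slotEquiv1 _ x).trans (ψ.prodCongr (Equiv.refl Bool))) c hc)
          (fun d => w (ψ (some d))) (w a :: t) (fun d => hw _)
          (by intro l hl; rcases List.mem_cons.1 hl with rfl | hl; exacts [hw _, ht l hl])
          (by
            rw [← hwt, ← ψ.sum_comp, Fintype.sum_option, hψ]
            simp only [List.flatten_cons, ← Multiset.coe_add]
            abel)
        convert key using 2 with ω
        have := Phi_close ψ x c w (X ω)
        rw [hψ] at this
        rw [this]
        simp [Tr]
        ring
      · let ψ₁ := Equiv.optionSubtypeNe a
        let b' : {d // d ≠ a} := ⟨b, fun h => hab h.symm⟩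
        let ψ : Option (Option {d // d ≠ b'}) ≃ κ :=
          (Equiv.optionCongr (Equiv.optionSubtypeNe b')).trans ψ₁
        have hψ0 : ψ none = a := by simp [ψ, ψ₁]
        have hψ1 : ψ (some none) = b := by simp [ψ, ψ₁, b']
        have hcard : Fintype.card (Option {d // d ≠ b'}) = N := by
          have := Fintype.card_congr ψ
          rw [Fintype.card_option] at this
          omega
        obtain ⟨z, hz⟩ := Phi_join ψ x y c w
        have hfl : ∀ x (l : List α), (flip x l : Multiset α) = l := by
          intro x l; cases x <;> simp [flip]
        have hfn : ∀ x (l : List α), l ≠ [] → flip x l ≠ [] := by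
          intro x l; cases x <;> simp [flip]
        have key := ih (Option {d // d ≠ b'}) hcard _ (inv_contr
          ((slotEquiv2 _ x y).trans (ψ.prodCongr (Equiv.refl Bool))) c hc)
          (fun d => d.elim (flip (!x) (w (ψ none)) ++ flip y (w (ψ (some none))))
          fun d' => w (ψ (some (some d')))) t
          (by
            rintro (_ | d)
            · simp [hfn _ _ (hw _)]
            · exact hw _) ht
          (by
            rw [← hwt, ← ψ.sum_comp, Fintype.sum_option, Fintype.sum_option, Fintype.sum_option]
            simp only [Option.elim, ← Multiset.coe_add, hfl]
            abel)
        convert Sp.smul_mem z key using 2 with ω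
        have := hz (X ω) (hX ω)
        rw [hψ0, hψ1] at this
        rw [this]
        simp [hψ0, hψ1]
        ring
    have hmem : c ∈ goodSub κ Sp X := by
      refine mem_of_Aop_mem _ (goodSub_Aop Sp X) ?_ c ?_
      · intro c hc0 π w t hw ht hwt
        obtain ⟨hD, hinj⟩ := Aop_ker c hc0
        obtain ⟨hb, hs⟩ := swap_antisymm c hD hinj
        by_cases hz : ∀ J, c J = 0
        · have : (fun I => c (I ∘ π)) = (0 : (κ × Bool → Fin (2 * r)) → ℂ) := by
            funext I; simp [hz]
          rw [this]
          exact Good.zero w t hw ht hwt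
        · push Not at hz
          obtain ⟨J, hJ⟩ := hz
          have hcard := Fintype.card_of_bijective (hb J hJ)
          have hcr : Fintype.card κ = r := by
            simp at hcard; omega
          let φ : κ ≃ Fin r := Fintype.equivFinOfCardEq hcr
          obtain ⟨z, hz⟩ := Phi_antisymm φ (fun I => c (I ∘ π))
            (fun J hJ => by
              have := hb _ hJ
              exact (Equiv.bijective_comp π J).1 this)
            (fun τ J => hs τ (J ∘ π)) w
          have key := H2 (fun i => w (φ.symm i)) t (fun i => hw _) ht
            (by rw [← hwt, ← φ.symm.sum_comp])
          convert Sp.smul_mem z key using 2 with ω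
          rw [hz]
          simp [mul_assoc]
      · rw [Aop_of_inv c hc]
        refine Submodule.sum_mem _ fun s _ => Submodule.sum_mem _ fun t _ => ?_
        split_ifs with hst
        · exact Submodule.zero_mem _
        · intro π
          rw [Kop_perm]
          exact hK _ (inv_perm π c hc) _ _ (fun h => hst (π.injective h))
    exact hmem 1

end Main
end SOInv

namespace SOInv
section Rot

variable {V : Type} [Fintype V] [DecidableEq V]

/-- generator of rotations in a coordinate plane -/
def Lm (a b : V) : Matrix V V ℂ := Matrix.single a b 1 - Matrix.single b a 1

/-- projection to a coordinate plane -/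
def Pm (a b : V) : Matrix V V ℂ := Matrix.single a a 1 + Matrix.single b b 1

/-- rotation in a coordinate plane -/
noncomputable def Rm (a b : V) (t : ℂ) : Matrix V V ℂ :=
  1 + Complex.sin t • Lm a b + (Complex.cos t - 1) • Pm a b

lemma Lm_Lm {a b : V} (h : a ≠ b) : Lm a b * Lm a b = - Pm a b := by
  simp [Lm, Pm, mul_sub, sub_mul, h, h.symm]
  abel
lemma Pm_Pm {a b : V} (h : a ≠ b) : Pm a b * Pm a b = Pm a b := by
  simp [Pm, mul_add, add_mul, h, h.symm]
lemma Lm_Pm {a b : V} (h : a ≠ b) : Lm a b * Pm a b = Lm a b := by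
  simp [Lm, Pm, mul_add, sub_mul, h, h.symm]
  abel
lemma Pm_Lm {a b : V} (h : a ≠ b) : Pm a b * Lm a b = Lm a b := by
  simp [Lm, Pm, mul_sub, add_mul, h, h.symm]

lemma Rm_mul {a b : V} (h : a ≠ b) (s t : ℂ) : Rm a b s * Rm a b t = Rm a b (s + t) := by
  simp only [Rm, mul_add, add_mul, mul_one, one_mul, Matrix.smul_mul, Matrix.mul_smul,
    Lm_Lm h, Pm_Pm h, Lm_Pm h, Pm_Lm h, Complex.sin_add, Complex.cos_add, smul_smul]
  module

lemma Rm_transpose (a b : V) (t : ℂ) : (Rm a b t).transpose = Rm a b (-t) := by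
  simp only [Rm, Matrix.transpose_add, Matrix.transpose_smul, Complex.sin_neg, Complex.cos_neg,
    Lm, Pm, Matrix.transpose_sub, Matrix.transpose_single, Matrix.transpose_one]
  module

lemma Rm_zero (a b : V) : Rm a b 0 = 1 := by simp [Rm]

lemma Rm_orth {a b : V} (h : a ≠ b) (t : ℂ) : (Rm a b t).transpose * Rm a b t = 1 := by
  rw [Rm_transpose, Rm_mul h, neg_add_cancel, Rm_zero]

lemma Rm_det {a b : V} (h : a ≠ b) (t : ℂ) : (Rm a b t).det = 1 := by
  have h1 : Rm a b t = Rm a b (t / 2) * Rm a b (t / 2) := by rw [Rm_mul h, add_halves]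
  have h2 := congrArg Matrix.det (Rm_orth h (t / 2))
  rw [Matrix.det_mul, Matrix.det_transpose, Matrix.det_one] at h2
  rw [h1, Matrix.det_mul, h2]

lemma Rm_deriv (a b : V) (x y : V) : HasDerivAt (fun t => Rm a b t x y) (Lm a b x y) 0 := by
  have h : (fun t => Rm a b t x y) = fun t => (1 : Matrix V V ℂ) x y + Complex.sin t * Lm a b x y
      + (Complex.cos t - 1) * Pm a b x y := by
    funext t; simp [Rm]
  rw [h]
  have h1 := (Complex.hasDerivAt_sin 0).mul_const (Lm a b x y)
  have h2 := ((Complex.hasDerivAt_cos 0).sub_const 1).mul_const (Pm a b x y)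
  have := (h1.const_add ((1 : Matrix V V ℂ) x y)).fun_add h2
  have h3 : Complex.cos 0 * Lm a b x y + -Complex.sin 0 * Pm a b x y = Lm a b x y := by simp
  rw [h3] at this
  exact this

lemma inv_of_group {ι : Type} [Fintype ι] [DecidableEq ι] (c : (ι → V) → ℂ)
    (hc : ∀ S : Matrix V V ℂ, S.transpose * S = 1 → S.det = 1 → ∀ J,
      c J = ∑ I : ι → V, (∏ s, S (I s) (J s)) * c I) : Inv c := by
  intro a b
  by_cases hab : a = b
  · rw [hab]
  funext J
  have h1 : HasDerivAt (fun t => ∑ I : ι → V, (∏ s, Rm a b t (I s) (J s)) * c I)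
      (∑ I : ι → V, (∑ s, (∏ u ∈ Finset.univ.erase s, Rm a b 0 (I u) (J u)) •
        Lm a b (I s) (J s)) * c I) 0 := by
    refine HasDerivAt.fun_sum fun I _ => ?_
    refine HasDerivAt.mul_const ?_ _
    exact HasDerivAt.fun_finsetProd fun s _ => Rm_deriv a b (I s) (J s)
  have h2 : (fun t => ∑ I : ι → V, (∏ s, Rm a b t (I s) (J s)) * c I) = fun _ => c J := by
    funext t
    exact (hc _ (Rm_orth hab t) (Rm_det hab t) J).symm
  rw [h2] at h1
  have h3 := h1.unique (hasDerivAt_const (0 : ℂ) (c J))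
  simp only [Rm_zero, Finset.sum_mul] at h3
  rw [Finset.sum_comm] at h3
  have h4 : ∀ s, ∑ I : ι → V, ((∏ u ∈ Finset.univ.erase s, (1 : Matrix V V ℂ) (I u) (J u)) •
        Lm a b (I s) (J s)) * c I = ∑ x, Lm a b x (J s) * c (update J s x) := by
    intro s
    symm
    refine Fintype.sum_of_injective (fun x => update J s x) (update_injective J s) _ _ ?_ ?_
    · intro I hI
      have : ∃ u ∈ Finset.univ.erase s, (1 : Matrix V V ℂ) (I u) (J u) = 0 := by
        by_contra hcon
        push Not at hcon
        apply hI
        refine ⟨I s, ?_⟩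
        funext u
        by_cases hu : u = s
        · subst hu; simp
        · have := hcon u (by simp [hu])
          by_contra hne
          apply this
          rw [Matrix.one_apply_ne]
          intro h
          apply hne
          simp [hu, h]
      obtain ⟨u, hu, hu0⟩ := this
      rw [Finset.prod_eq_zero hu hu0]
      simp
    · intro x
      have : ∏ u ∈ Finset.univ.erase s, (1 : Matrix V V ℂ) (update J s x u) (J u) = 1 := by
        refine Finset.prod_eq_one fun u hu => ?_
        have : u ≠ s := (Finset.mem_erase.1 hu).1
        rw [update_of_ne this]
        exact Matrix.one_apply_eq _
      simp only [this]
      simp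
  simp only [h4] at h3
  have h5 : ∀ s, ∑ x, Lm a b x (J s) * c (update J s x) =
      (if J s = b then c (update J s a) else 0) - (if J s = a then c (update J s b) else 0) := by
    intro s
    simp only [Lm, Matrix.sub_apply, sub_mul, Finset.sum_sub_distrib, Matrix.single_apply,
      ite_mul, one_mul, zero_mul, ite_and]
    simp [eq_comm]
  simp only [h5, Finset.sum_sub_distrib] at h3
  exact (sub_eq_zero.1 h3).symm

end Rot

lemma coe_flatten {α : Type} (L : List (List α)) :
    Multiset.ofList L.flatten = (L.map Multiset.ofList).sum := by
  induction L with
  | nil => simp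
  | cons a L ih => rw [List.flatten_cons, ← Multiset.coe_add, ih]; simp

section Coord

variable {n k : ℕ}

/-- the skew-symmetrized elementary matrices -/
noncomputable def skewE (p q : Fin n) : soSubmodule n :=
  ⟨(1 / 2 : ℂ) • (Matrix.single p q 1 - Matrix.single q p 1), by
    change Matrix.transpose _ = - _
    simp only [Matrix.transpose_smul, Matrix.transpose_sub, Matrix.transpose_single]
    module⟩

lemma sum_skewE (B : Matrix (Fin n) (Fin n) ℂ) :
    ((∑ x : Fin n × Fin n, B x.1 x.2 • skewE x.1 x.2 : soSubmodule n) :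
      Matrix (Fin n) (Fin n) ℂ) = (1 / 2 : ℂ) • (B - B.transpose) := by
  ext i j
  rw [AddSubmonoidClass.coe_finsetSum, Matrix.sum_apply, Fintype.sum_prod_type]
  simp only [skewE, Submodule.coe_smul, Matrix.smul_apply, Matrix.sub_apply, smul_eq_mul,
    Matrix.transpose_apply, mul_sub, Finset.sum_sub_distrib, Matrix.single_apply, ite_and]
  congr 1
  · simp [mul_comm]
  · rw [Finset.sum_comm]
    simp [mul_comm]

/-- index functions on pairs of slots -/
def pairEquiv (κ W : Type) : (κ → W × W) ≃ (κ × Bool → W) where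
  toFun g p := if p.2 then (g p.1).2 else (g p.1).1
  invFun I d := (I (d, false), I (d, true))
  left_inv g := by funext d; simp
  right_inv I := by funext ⟨d, b⟩; cases b <;> simp

/-- coefficient tensor of a multilinear map -/
noncomputable def coeffT (f : MultilinearMap ℂ (fun _ : Fin k => ↥(soSubmodule n)) ℂ) :
    (Fin k × Bool → Fin n) → ℂ :=
  fun I => f fun i => skewE (I (i, false)) (I (i, true))

lemma expand (f : MultilinearMap ℂ (fun _ : Fin k => ↥(soSubmodule n)) ℂ)
    (B : Fin k → Matrix (Fin n) (Fin n) ℂ) (Y : Fin k → soSubmodule n)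
    (hY : ∀ i, (Y i : Matrix (Fin n) (Fin n) ℂ) = (1 / 2 : ℂ) • (B i - (B i).transpose)) :
    f Y = ∑ I : Fin k × Bool → Fin n, coeffT f I * ∏ i, B i (I (i, false)) (I (i, true)) := by
  have h : Y = fun i => ∑ x : Fin n × Fin n, B i x.1 x.2 • skewE x.1 x.2 := by
    funext i
    apply Subtype.ext
    rw [sum_skewE, hY]
  rw [h, MultilinearMap.map_sum]
  rw [← (pairEquiv (Fin k) (Fin n)).sum_comp]
  refine Finset.sum_congr rfl fun g _ => ?_
  rw [MultilinearMap.map_smul_univ]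
  simp [pairEquiv, coeffT, mul_comm]

lemma coeffT_inv (f : MultilinearMap ℂ (fun _ : Fin k => ↥(soSubmodule n)) ℂ)
    (hf : ∀ S : Matrix (Fin n) (Fin n) ℂ,
      S.transpose * S = 1 → S.det = 1 →
      ∀ X Y : Fin k → ↥(soSubmodule n),
        (∀ i, (Y i : Matrix (Fin n) (Fin n) ℂ)
            = S * (X i : Matrix (Fin n) (Fin n) ℂ) * S⁻¹) →
        f Y = f X) : Inv (coeffT f) := by
  refine inv_of_group _ fun S hS hdet J => ?_
  have hinv : S⁻¹ = S.transpose := Matrix.inv_eq_left_inv hS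
  let X : Fin k → soSubmodule n := fun i => skewE (J (i, false)) (J (i, true))
  let B : Fin k → Matrix (Fin n) (Fin n) ℂ := fun i =>
    S * Matrix.single (J (i, false)) (J (i, true)) 1 * S.transpose
  let Y : Fin k → soSubmodule n := fun i => ∑ x : Fin n × Fin n, B i x.1 x.2 • skewE x.1 x.2
  have hY : ∀ i, (Y i : Matrix (Fin n) (Fin n) ℂ) = (1 / 2 : ℂ) • (B i - (B i).transpose) :=
    fun i => sum_skewE (B i)
  have h1 : f Y = f X := by
    refine hf S hS hdet X Y fun i => ?_
    rw [hY, hinv]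
    simp only [B, X, skewE, Matrix.transpose_mul, Matrix.transpose_transpose,
      Matrix.transpose_single, Matrix.mul_smul, Matrix.smul_mul, mul_sub, sub_mul, mul_assoc]
  have h2 := expand f B Y hY
  rw [h1] at h2
  have h3 : coeffT f J = f X := rfl
  rw [h3, h2]
  refine Finset.sum_congr rfl fun I _ => ?_
  rw [mul_comm, Fintype.prod_prod_type]
  congr 1
  refine Finset.prod_congr rfl fun i _ => ?_
  rw [Fintype.prod_bool]
  simp [B, Matrix.mul_apply, Matrix.single_apply, ite_and, mul_comm]

end Coord
end SOInv

theorem invariant_multilinear_so_even_mem_span_traces_and_leviCivita_chains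
    (r k : ℕ) (hr : 1 ≤ r)
    (f : MultilinearMap ℂ (fun _ : Fin k => ↥(soSubmodule (2 * r))) ℂ)
    (hf : ∀ S : Matrix (Fin (2 * r)) (Fin (2 * r)) ℂ,
      S.transpose * S = 1 → S.det = 1 →
      ∀ X Y : Fin k → ↥(soSubmodule (2 * r)),
        (∀ i, (Y i : Matrix (Fin (2 * r)) (Fin (2 * r)) ℂ)
            = S * (X i : Matrix (Fin (2 * r)) (Fin (2 * r)) ℂ) * S⁻¹) →
        f Y = f X) :
    ⇑f ∈ Submodule.span ℂ
      ({h : (Fin k → ↥(soSubmodule (2 * r))) → ℂ |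
          ∃ σ : Equiv.Perm (Fin k),
            h = fun X => ∑ j : Fin k → Fin (2 * r), ∏ i : Fin k,
              (X i : Matrix (Fin (2 * r)) (Fin (2 * r)) ℂ) (j i) (j (σ i))} ∪
       {h : (Fin k → ↥(soSubmodule (2 * r))) → ℂ |
          ∃ (w : Fin r → List (Fin k)) (_ : ∀ i, w i ≠ [])
            (_ : (List.ofFn w).flatten.Nodup)
            (σ' : Equiv.Perm {j : Fin k // j ∉ (List.ofFn w).flatten}),
            h = fun X =>
              (∑ τ : Equiv.Perm (Fin (2 * r)), ((Equiv.Perm.sign τ : ℤ) : ℂ) *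
                  ∏ i : Fin r,
                    ((w i).map fun j => (X j : Matrix (Fin (2 * r)) (Fin (2 * r)) ℂ)).prod
                      (τ ⟨(i : ℕ), by have := i.2; omega⟩)
                      (τ ⟨r + (i : ℕ), by have := i.2; omega⟩)) *
              ∑ j : {j : Fin k // j ∉ (List.ofFn w).flatten} → Fin (2 * r),
                ∏ i : {j : Fin k // j ∉ (List.ofFn w).flatten},
                  (X i.1 : Matrix (Fin (2 * r)) (Fin (2 * r)) ℂ) (j i) (j (σ' i))}) := by
  have hXs : ∀ (ω : Fin k → ↥(soSubmodule (2 * r))) (i : Fin k),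
      (ω i : Matrix (Fin (2 * r)) (Fin (2 * r)) ℂ).transpose = -(ω i : Matrix _ _ ℂ) :=
    fun ω i => (ω i).2
  set Sp := Submodule.span ℂ
      ({h : (Fin k → ↥(soSubmodule (2 * r))) → ℂ |
          ∃ σ : Equiv.Perm (Fin k),
            h = fun X => ∑ j : Fin k → Fin (2 * r), ∏ i : Fin k,
              (X i : Matrix (Fin (2 * r)) (Fin (2 * r)) ℂ) (j i) (j (σ i))} ∪
       {h : (Fin k → ↥(soSubmodule (2 * r))) → ℂ |
          ∃ (w : Fin r → List (Fin k)) (_ : ∀ i, w i ≠ [])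
            (_ : (List.ofFn w).flatten.Nodup)
            (σ' : Equiv.Perm {j : Fin k // j ∉ (List.ofFn w).flatten}),
            h = fun X =>
              (∑ τ : Equiv.Perm (Fin (2 * r)), ((Equiv.Perm.sign τ : ℤ) : ℂ) *
                  ∏ i : Fin r,
                    ((w i).map fun j => (X j : Matrix (Fin (2 * r)) (Fin (2 * r)) ℂ)).prod
                      (τ ⟨(i : ℕ), by have := i.2; omega⟩)
                      (τ ⟨r + (i : ℕ), by have := i.2; omega⟩)) *
              ∑ j : {j : Fin k // j ∉ (List.ofFn w).flatten} → Fin (2 * r),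
                ∏ i : {j : Fin k // j ∉ (List.ofFn w).flatten},
                  (X i.1 : Matrix (Fin (2 * r)) (Fin (2 * r)) ℂ) (j i) (j (σ' i))}) with hSp
  have hgood := SOInv.main_induction (α := Fin k) (r := r) Sp
    (fun ω i => (ω i : Matrix (Fin (2 * r)) (Fin (2 * r)) ℂ)) hXs
    (by
      intro t ht hcov
      have hnd : t.flatten.Nodup := by
        rw [← Multiset.coe_nodup, hcov]; exact Finset.univ.nodup
      have hmem : ∀ x, x ∈ t.flatten := by
        intro x
        rw [← Multiset.mem_coe, hcov]; simp
      obtain ⟨σ, hσ⟩ := SOInv.Tr_eq_perm (V := Fin (2 * r)) (id : Fin k → Fin k)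
        Function.injective_id t ht hnd (fun x => by simp [hmem x])
      refine Submodule.subset_span (Or.inl ⟨σ, ?_⟩)
      funext ω
      exact hσ _)
    (by
      intro w t hw ht hcov
      have hsum : Multiset.ofList (List.ofFn w).flatten = ∑ d, (w d : Multiset (Fin k)) := by
        rw [← List.sum_ofFn, SOInv.coe_flatten, List.map_ofFn]
        rfl
      rw [← hsum, Multiset.coe_add] at hcov
      have hnd : ((List.ofFn w).flatten ++ t.flatten).Nodup := by
        rw [← Multiset.coe_nodup, hcov]; exact Finset.univ.nodup
      have hmem : ∀ x, x ∈ (List.ofFn w).flatten ++ t.flatten := by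
        intro x
        rw [← Multiset.mem_coe, hcov]; simp
      rw [List.nodup_append] at hnd
      obtain ⟨σ, hσ⟩ := SOInv.Tr_eq_perm (V := Fin (2 * r))
        (Subtype.val : {j : Fin k // j ∉ (List.ofFn w).flatten} → Fin k)
        Subtype.val_injective t ht hnd.2.1 (fun x => by
          constructor
          · intro hx
            exact ⟨⟨x, fun h => hnd.2.2 x h x hx rfl⟩, rfl⟩
          · rintro ⟨b, rfl⟩
            exact (List.mem_append.1 (hmem b.1)).resolve_left b.2)
      refine Submodule.subset_span (Or.inr ⟨w, hw, hnd.1, σ, ?_⟩)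
      funext ω
      exact congrArg _ (hσ _))
    (Fintype.card (Fin k)) (Fin k) rfl (SOInv.coeffT f) (SOInv.coeffT_inv f hf)
    (fun i => [i]) [] (by simp) (by simp)
    (by
      simp only [List.flatten_nil, Multiset.coe_nil, add_zero, Multiset.coe_singleton]
      exact Finset.sum_multiset_singleton _)
  convert hgood using 1
  funext ω
  rw [SOInv.expand f (fun i => (ω i : Matrix (Fin (2 * r)) (Fin (2 * r)) ℂ)) ω (by
    intro i
    rw [hXs]
    module)]
  simp [SOInv.Phi, SOInv.Tr, SOInv.word]
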